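/- arXiv:1507.04717 — 2 statements merged into one kernel-verified Lean document; each statement's English description precedes it below -/
import Mathlib

section
/- Let A be a positive bounded operator on a separable Hilbert space H, V : K → H a partial isometry (V*V = I on K), and B a bounded operator on K. Then for all 0 ≤ r, s ≤ 1/2, ‖A^r V B V* A^s‖ ≤ ‖(V*AV)^r B (V*AV)^s‖. -/
open ContinuousLinearMap

section

variable {G H K : Type*}
  [NormedAddCommGroup G] [InnerProductSpace ℂ G]
  [NormedAddCommGroup H] [InnerProductSpace ℂ H] [CompleteSpace H]
  [NormedAddCommGroup K] [InnerProductSpace ℂ K] [CompleteSpace K]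

/-- The continuous functional calculus respects intertwining of self-adjoint operators. -/
theorem cfc_comp_eq_comp_cfc {M : H →L[ℂ] H} {X : K →L[ℂ] K} (hM : IsSelfAdjoint M)
    (hX : IsSelfAdjoint X) {T : K →L[ℂ] H} (h : M ∘L T = T ∘L X) {f : ℝ → ℝ}
    (hf : ContinuousOn f (spectrum ℝ M ∪ spectrum ℝ X)) :
    cfc f M ∘L T = T ∘L cfc f X := by
  set s := spectrum ℝ M ∪ spectrum ℝ X
  have hMs : spectrum ℝ M ⊆ s := Set.subset_union_left
  have hXs : spectrum ℝ X ⊆ s := Set.subset_union_right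
  have : CompactSpace s := isCompact_iff_compactSpace.mp <|
    (ContinuousFunctionalCalculus.isCompact_spectrum M).union
      (ContinuousFunctionalCalculus.isCompact_spectrum X)
  have key (g : C(s, ℝ)) : cfcHomSuperset hM hMs g ∘L T = T ∘L cfcHomSuperset hX hXs g := by
    induction g using ContinuousMap.induction_on_of_compact with
    | const r =>
      have : ContinuousMap.const s r = algebraMap ℝ C(s, ℝ) r := rfl
      rw [this, AlgHomClass.commutes, AlgHomClass.commutes]
      ext x
      simp [Algebra.algebraMap_eq_smul_one]
    | id => simpa only [cfcHomSuperset_id] using h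
    | star_id => simpa only [star_trivial, cfcHomSuperset_id] using h
    | add f g hf hg => simp only [map_add, add_comp, comp_add, hf, hg]
    | mul f g hf hg =>
      simp only [map_mul, mul_def]
      rw [comp_assoc, hg, ← comp_assoc, hf, comp_assoc]
    | frequently f hf =>
      have hcM := cfcHomSuperset_continuous hM hMs
      have hcX := cfcHomSuperset_continuous hX hXs
      exact hf.mem_of_closed <| isClosed_eq (hcM.clm_comp continuous_const)
        (continuous_const.clm_comp hcX)
  have := key ⟨s.domRestrict f, hf.domRestrict⟩
  rw [cfc_apply f M hM (hf.mono hMs), cfc_apply f X hX (hf.mono hXs)]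
  exact this

theorem rpow_comp_eq_comp_rpow {M : H →L[ℂ] H} {X : K →L[ℂ] K} (hM : 0 ≤ M) (hX : 0 ≤ X)
    {T : K →L[ℂ] H} (h : M ∘L T = T ∘L X) {p : ℝ} (hp : 0 ≤ p) :
    (M ^ p) ∘L T = T ∘L (X ^ p) := by
  rw [CFC.rpow_eq_cfc_real hM, CFC.rpow_eq_cfc_real hX]
  exact cfc_comp_eq_comp_cfc hM.isSelfAdjoint hX.isSelfAdjoint h
    (Real.continuous_rpow_const hp).continuousOn

/-- Hansen's inequality for an isometry `V` and the operator concave function `x ↦ x ^ p`. -/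
theorem adjoint_comp_rpow_comp_le {A : H →L[ℂ] H} (hA : 0 ≤ A) {V : K →L[ℂ] H}
    (hV : adjoint V ∘L V = 1) {p : ℝ} (hp : p ∈ Set.Icc (0 : ℝ) 1) :
    adjoint V ∘L (A ^ p) ∘L V ≤ (adjoint V ∘L A ∘L V) ^ p := by
  have hVV (x : K) : adjoint V (V x) = x := DFunLike.congr_fun hV x
  -- The reflection `U` fixes the range of `V`, and averaging `A` over `U` gives an operator `D`
  -- that is reduced by that range.
  set U : H →L[ℂ] H := (2 : ℂ) • (V ∘L adjoint V) - 1 with hU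
  have hUU : U ∘L U = 1 := by
    ext x
    simp [hU, hVV, two_smul]
  have hUV : U ∘L V = V := by
    ext x
    simp [hU, hVV, two_smul]
  have hVU : adjoint V ∘L U = adjoint V := by
    ext x
    simp [hU, hVV, two_smul]
  have hU_adj : adjoint U = U := by
    have h2 : (starRingEnd ℂ) 2 = 2 := map_ofNat _ 2
    simp [hU, map_smulₛₗ, h2, adjoint_comp, ← star_eq_adjoint (1 : H →L[ℂ] H)]
  have hA' := (nonneg_iff_isPositive A).mp hA
  have hC : 0 ≤ U ∘L A ∘L U := by
    simpa only [hU_adj] using (nonneg_iff_isPositive _).mpr (hA'.conj_adjoint U)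
  have hX : 0 ≤ adjoint V ∘L A ∘L V := (nonneg_iff_isPositive _).mpr (hA'.adjoint_conj V)
  set D : H →L[ℂ] H := (1 / 2 : ℝ) • A + (1 / 2 : ℝ) • (U ∘L A ∘L U)
  have hD : 0 ≤ D := by positivity
  have hDV : D ∘L V = V ∘L (adjoint V ∘L A ∘L V) := by
    ext x
    have : U (V x) = V x := DFunLike.congr_fun hUV x
    simp only [D, add_apply, comp_apply, smul_apply, this]
    rw [← smul_add, hU]
    simp only [sub_apply, smul_apply, comp_apply, one_apply_eq_self, add_sub_cancel]
    module
  have hconc : (1 / 2 : ℝ) • A ^ p + (1 / 2 : ℝ) • (U ∘L A ∘L U) ^ p ≤ D ^ p :=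
    (CFC.concaveOn_rpow hp).2 hA hC (by norm_num) (by norm_num) (by norm_num)
  have hCU : ((U ∘L A ∘L U) ^ p) ∘L U = U ∘L (A ^ p) :=
    rpow_comp_eq_comp_rpow hC hA (by simp only [comp_assoc, hUU]; rfl) hp.1
  have hCV : adjoint V ∘L ((U ∘L A ∘L U) ^ p) ∘L V = adjoint V ∘L (A ^ p) ∘L V := by
    nth_rw 2 [← hUV]
    rw [← comp_assoc _ U V, hCU, comp_assoc, ← comp_assoc, hVU]
  have hle := ((le_def _ _).mp hconc).adjoint_conj V
  rw [le_def]
  convert hle using 1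
  rw [sub_comp, comp_sub, rpow_comp_eq_comp_rpow hD hX hDV hp.1, ← comp_assoc (adjoint V) V, hV,
    add_comp, comp_add, smul_comp, comp_smul, smul_comp, comp_smul, hCV, ← add_smul]
  norm_num
  rfl

theorem norm_comp_le_norm_comp_of_adjoint_comp_self_le {E F : Type*}
    [NormedAddCommGroup E] [InnerProductSpace ℂ E] [CompleteSpace E]
    [NormedAddCommGroup F] [InnerProductSpace ℂ F] [CompleteSpace F]
    {S : K →L[ℂ] E} {T : K →L[ℂ] F} (h : adjoint S ∘L S ≤ adjoint T ∘L T) (Z : G →L[ℂ] K) :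
    ‖S ∘L Z‖ ≤ ‖T ∘L Z‖ := by
  have hpt (x : K) : ‖S x‖ ≤ ‖T x‖ := by
    rw [← sq_le_sq₀ (norm_nonneg _) (norm_nonneg _), apply_norm_sq_eq_inner_adjoint_left,
      apply_norm_sq_eq_inner_adjoint_left]
    have := ((le_def _ _).mp h).re_inner_nonneg_left x
    rw [sub_apply, inner_sub_left, map_sub, sub_nonneg] at this
    exact this
  exact opNorm_le_bound _ (norm_nonneg _) fun x => (hpt (Z x)).trans (le_opNorm (T ∘L Z) x)

theorem rpow_comp_rpow_self {A : H →L[ℂ] H} (hA : 0 ≤ A) {r : ℝ} (hr : 0 ≤ r) :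
    (A ^ r) ∘L (A ^ r) = A ^ (2 * r) := by
  rw [mul_comm, ← CFC.rpow_rpow_of_exponent_nonneg A r 2 hr zero_le_two hA,
    ← Nat.cast_ofNat (R := ℝ), CFC.rpow_natCast _ 2 CFC.rpow_nonneg, sq]
  rfl

theorem adjoint_rpow (A : H →L[ℂ] H) (r : ℝ) : adjoint (A ^ r) = A ^ r :=
  (CFC.rpow_nonneg (a := A) (y := r)).isSelfAdjoint.adjoint_eq

theorem norm_rpow_comp_comp_le {A : H →L[ℂ] H} (hA : 0 ≤ A) {V : K →L[ℂ] H}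
    (hV : adjoint V ∘L V = 1) {r : ℝ} (hr0 : 0 ≤ r) (hr : r ≤ 1 / 2) (Z : G →L[ℂ] K) :
    ‖(A ^ r) ∘L V ∘L Z‖ ≤ ‖((adjoint V ∘L A ∘L V) ^ r) ∘L Z‖ := by
  have hX : 0 ≤ adjoint V ∘L A ∘L V :=
    (nonneg_iff_isPositive _).mpr (((nonneg_iff_isPositive A).mp hA).adjoint_conj V)
  rw [← comp_assoc]
  refine norm_comp_le_norm_comp_of_adjoint_comp_self_le ?_ Z
  rw [adjoint_comp, adjoint_rpow, adjoint_rpow, rpow_comp_rpow_self hX hr0, comp_assoc,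
    ← comp_assoc (A ^ r), rpow_comp_rpow_self hA hr0]
  exact adjoint_comp_rpow_comp_le hA hV ⟨by linarith, by linarith⟩

end

/-- For a positive `A`, an isometry `V` and bounded `B`:
`‖A^r V B V* A^s‖ ≤ ‖(V*AV)^r B (V*AV)^s‖` for `0 ≤ r, s ≤ 1/2`. -/
theorem norm_rpow_comp_isometry_le
    {H K : Type*}
    [NormedAddCommGroup H] [InnerProductSpace ℂ H] [CompleteSpace H]
    [NormedAddCommGroup K] [InnerProductSpace ℂ K] [CompleteSpace K]
    (A : H →L[ℂ] H) (hA : A.IsPositive)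
    (V : K →L[ℂ] H) (hV : adjoint V ∘L V = 1)
    (B : K →L[ℂ] K)
    (r s : ℝ) (hr0 : 0 ≤ r) (hr : r ≤ 1/2) (hs0 : 0 ≤ s) (hs : s ≤ 1/2) :
    ‖CFC.rpow A r ∘L V ∘L B ∘L adjoint V ∘L CFC.rpow A s‖ ≤
      ‖CFC.rpow (adjoint V ∘L A ∘L V) r * B * CFC.rpow (adjoint V ∘L A ∘L V) s‖ := by
  have hA' := (nonneg_iff_isPositive A).mpr hA
  simp only [CFC.rpow_eq_pow, mul_def]
  set X := adjoint V ∘L A ∘L V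
  calc ‖(A ^ r) ∘L V ∘L B ∘L adjoint V ∘L (A ^ s)‖
      ≤ ‖(X ^ r) ∘L B ∘L adjoint V ∘L (A ^ s)‖ := norm_rpow_comp_comp_le hA' hV hr0 hr _
    _ = ‖(A ^ s) ∘L V ∘L adjoint B ∘L (X ^ r)‖ := by
      rw [← LinearIsometryEquiv.norm_map adjoint]
      simp only [adjoint_comp, adjoint_rpow, adjoint_adjoint, comp_assoc]
    _ ≤ ‖(X ^ s) ∘L adjoint B ∘L (X ^ r)‖ := norm_rpow_comp_comp_le hA' hV hs0 hs _
    _ = ‖((X ^ r) ∘L B) ∘L (X ^ s)‖ := by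
      rw [← LinearIsometryEquiv.norm_map adjoint]
      simp only [adjoint_comp, adjoint_rpow, adjoint_adjoint]
end

section
/- (Hansen's inequality, special case) Let A be a positive bounded operator on a Hilbert space H and V an isometry into H. Then for every 0 ≤ t ≤ 1/2's double, i.e., for every 0 ≤ α ≤ 1, the operator (V*AV)^α − V*A^αV is positive. -/
open ContinuousLinearMap

open scoped NNReal

namespace CStarAlgebra

variable {A : Type*} [CStarAlgebra A] [PartialOrder A] [StarOrderedRing A]

/-- If the projection `p` commutes with `y` and `py = pxp` with `x` positive, then
`p y⁻¹ p ≤ p x⁻¹ p`. -/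
lemma projection_conj_inv_le {p : A} (hp : IsStarProjection p) (x y : Aˣ) (hx : 0 ≤ (x : A))
    (hy : IsSelfAdjoint (y : A)) (hyx : p * y = p * x * p) (hpy : Commute p (y : A)) :
    p * (↑y⁻¹ : A) * p ≤ p * (↑x⁻¹ : A) * p := by
  have hpp : p * p = p := hp.isIdempotentElem
  have hps : star p = p := hp.isSelfAdjoint
  have hc : p * (↑y⁻¹ : A) = ↑y⁻¹ * p := hpy.units_inv_right
  have hxs : star (↑x⁻¹ : A) = ↑x⁻¹ := by
    rw [← Units.coe_star_inv, show star x = x from Units.ext hx.isSelfAdjoint]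
  have hys : star (↑y⁻¹ : A) = ↑y⁻¹ := by
    rw [← Units.coe_star_inv, show star y = y from Units.ext hy]
  have key := star_left_conjugate_nonneg hx (p * (↑y⁻¹ : A) - ↑x⁻¹ * p)
  have h₁ : (↑y⁻¹ : A) * p * x * p * ↑y⁻¹ = p * ↑y⁻¹ * p := by
    calc (↑y⁻¹ : A) * p * x * p * ↑y⁻¹ = ↑y⁻¹ * (p * x * p) * ↑y⁻¹ := by simp only [mul_assoc]
      _ = p * ↑y⁻¹ * p := by
        rw [← hyx, mul_assoc, mul_assoc, Units.mul_inv, mul_one, hc, mul_assoc, hpp]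
  have h₂ : (↑y⁻¹ : A) * p * p = p * ↑y⁻¹ * p := by rw [hc]
  have h₃ : p * (p * (↑y⁻¹ : A)) = p * ↑y⁻¹ * p := by rw [mul_assoc, ← hc]
  rw [← sub_nonneg]
  convert key using 1
  rw [star_sub, star_mul, star_mul, hps, hxs, hys]
  calc p * (↑x⁻¹ : A) * p - p * ↑y⁻¹ * p
      = ↑y⁻¹ * p * x * p * ↑y⁻¹ - ↑y⁻¹ * p * p - p * (p * ↑y⁻¹) + p * ↑x⁻¹ * p := by
        rw [h₁, h₂, h₃]; abel
    _ = ↑y⁻¹ * p * x * p * ↑y⁻¹ - ↑y⁻¹ * p * (x * ↑x⁻¹) * p - p * (↑x⁻¹ * x) * (p * ↑y⁻¹)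
          + p * ↑x⁻¹ * (x * ↑x⁻¹) * p := by simp
    _ = _ := by noncomm_ring

end CStarAlgebra

namespace CFC

open Real MeasureTheory Set

variable {A : Type*} [CStarAlgebra A] [PartialOrder A] [StarOrderedRing A]

lemma cfc_rpowIntegrand₀₁_eq_sub_ringInverse {r t : ℝ} (hr : r ∈ Ioo 0 1) (ht : 0 < t) {x : A}
    (hx : 0 ≤ x) :
    cfc (rpowIntegrand₀₁ r t) x =
      algebraMap ℝ A (t ^ (r - 1)) - t ^ r • Ring.inverse (algebraMap ℝ A t + x) := by
  rw [rpowIntegrand₀₁_eq_sub hr.2.ne ht]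
  have hspec : ∀ s ∈ spectrum ℝ x, t + s ≠ 0 := fun s hs ↦
    (add_pos_of_pos_of_nonneg ht (spectrum_nonneg_of_nonneg hx hs)).ne'
  have hg : ContinuousOn (fun z : ℝ ↦ (t + z)⁻¹) (spectrum ℝ x) := by
    fun_prop (disch := exact hspec)
  rw [cfc_sub (fun _ : ℝ ↦ t ^ (r - 1)) (fun z : ℝ ↦ t ^ r * (t + z)⁻¹) x continuousOn_const
      (continuousOn_const.mul hg), cfc_const _ x, cfc_const_mul _ _ x hg,
    cfc_inv (fun z : ℝ ↦ t + z) x hspec, cfc_const_add t (fun z : ℝ ↦ z) x, cfc_id' ℝ x]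

/-- Compression inequality for the integrand of the fractional power. -/
lemma projection_conj_cfcₙ_rpowIntegrand₀₁_le {r t : ℝ} (hr : r ∈ Ioo 0 1) (ht : 0 < t) {p a : A}
    (hp : IsStarProjection p) (ha : 0 ≤ a) :
    p * cfcₙ (rpowIntegrand₀₁ r t) a * p ≤ p * cfcₙ (rpowIntegrand₀₁ r t) (p * a * p) * p := by
  have hb : 0 ≤ p * a * p := hp.isSelfAdjoint.conjugate_nonneg ha
  have hpp : p * p = p := hp.isIdempotentElem
  have hcont : ∀ {x : A}, 0 ≤ x → ContinuousOn (rpowIntegrand₀₁ r t) (quasispectrum ℝ x) :=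
    fun hx ↦ (continuousOn_rpowIntegrand₀₁_Ici hr ht).mono
      fun s hs ↦ quasispectrum_nonneg_of_nonneg _ hx s hs
  have hpos : ∀ {x : A}, 0 ≤ x → IsStrictlyPositive (algebraMap ℝ A t + x) := by
    intro x hx
    grind
  rw [cfcₙ_eq_cfc (hcont ha), cfcₙ_eq_cfc (hcont hb),
    cfc_rpowIntegrand₀₁_eq_sub_ringInverse hr ht ha,
    cfc_rpowIntegrand₀₁_eq_sub_ringInverse hr ht hb]
  obtain ⟨x, hx⟩ := (hpos ha).isUnit
  obtain ⟨y, hy⟩ := (hpos hb).isUnit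
  have htp : p * algebraMap ℝ A t = algebraMap ℝ A t * p := (Algebra.commutes t p).symm
  have key := CStarAlgebra.projection_conj_inv_le hp x y (hx ▸ (hpos ha).nonneg)
    (hy ▸ (hpos hb).nonneg.isSelfAdjoint)
    (by
      rw [hx, hy, mul_add, mul_add, add_mul, htp, mul_assoc _ p p, ← mul_assoc p (p * a) p,
        ← mul_assoc p p a, hpp])
    (by
      rw [hy]
      refine Commute.add_right htp ?_
      change p * (p * a * p) = p * a * p * p
      rw [mul_assoc (p * a), hpp, ← mul_assoc, ← mul_assoc, hpp])
  rw [← hx, ← hy, Ring.inverse_unit, Ring.inverse_unit]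
  simp only [mul_sub, sub_mul, mul_smul_comm, smul_mul_assoc]
  gcongr

/-- Compression inequality for fractional powers. -/
lemma projection_conj_nnrpow_le {r : ℝ≥0} (hr : r ∈ Ioo 0 1) {p a : A}
    (hp : IsStarProjection p) (ha : 0 ≤ a) :
    p * a ^ r * p ≤ p * (p * a * p) ^ r * p := by
  obtain ⟨μ, hμ⟩ := exists_measure_nnrpow_eq_integral_cfcₙ_rpowIntegrand₀₁ A hr
  obtain ⟨hia, hea⟩ := hμ a ha
  obtain ⟨hib, heb⟩ := hμ (p * a * p) (hp.isSelfAdjoint.conjugate_nonneg ha)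
  let L : A →L[ℝ] A := mulLeftRight ℝ A p p
  change L (a ^ r) ≤ L ((p * a * p) ^ r)
  rw [hea, heb, ← L.integral_comp_comm hia, ← L.integral_comp_comm hib]
  refine integral_mono_ae (L.integrable_comp hia) (L.integrable_comp hib) ?_
  filter_upwards [ae_restrict_mem measurableSet_Ioi] with t ht
  exact projection_conj_cfcₙ_rpowIntegrand₀₁_le hr ht hp ha

/-- Non-unital star homomorphisms preserve positive powers. -/
lemma map_nnrpow {A B : Type*} [NonUnitalCStarAlgebra A] [PartialOrder A] [StarOrderedRing A]
    [NonUnitalCStarAlgebra B] [PartialOrder B] [StarOrderedRing B] (φ : A →⋆ₙₐ[ℂ] B)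
    (r : ℝ≥0) (hr : 0 < r) {a : A} (ha : 0 ≤ a) (hφa : 0 ≤ φ a) : φ (a ^ r) = φ a ^ r := by
  rw [nnrpow_eq_cfcₙ_real a r, nnrpow_eq_cfcₙ_real (φ a) r]
  exact φ.map_cfcₙ (fun x : ℝ ↦ x ^ (r : ℝ)) a
    (Real.continuous_rpow_const (by positivity)).continuousOn
    (Real.zero_rpow (by positivity)) (by fun_prop) ha.isSelfAdjoint hφa.isSelfAdjoint

end CFC

namespace ContinuousLinearMap

variable {H K : Type*} [NormedAddCommGroup H] [InnerProductSpace ℂ H] [CompleteSpace H]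
  [NormedAddCommGroup K] [InnerProductSpace ℂ K] [CompleteSpace K]

lemma adjoint_comp_comp_of_isometry {V : K →L[ℂ] H} (hV : adjoint V ∘L V = 1)
    {E : Type*} [NormedAddCommGroup E] [NormedSpace ℂ E] (T : E →L[ℂ] K) :
    adjoint V ∘L V ∘L T = T := by
  rw [← comp_assoc, hV]; rfl

/-- Conjugation by an isometry, as a non-unital star homomorphism. -/
noncomputable def isometryConj (V : K →L[ℂ] H) (hV : adjoint V ∘L V = 1) :
    (K →L[ℂ] K) →⋆ₙₐ[ℂ] (H →L[ℂ] H) where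
  toFun T := V ∘L T ∘L adjoint V
  map_smul' c T := by simp
  map_zero' := by simp
  map_add' S T := by simp
  map_mul' S T := by
    simp only [mul_def, comp_assoc, adjoint_comp_comp_of_isometry hV]
  map_star' T := by
    simp only [star_eq_adjoint, adjoint_comp, adjoint_adjoint, comp_assoc]

end ContinuousLinearMap

/-- Hansen's inequality: for a positive `A` and an isometry `V`,
`(V*AV)^α − V*A^αV` is positive for every `0 ≤ α ≤ 1`. -/
theorem hansen_inequality
    {H K : Type*}
    [NormedAddCommGroup H] [InnerProductSpace ℂ H] [CompleteSpace H]
    [NormedAddCommGroup K] [InnerProductSpace ℂ K] [CompleteSpace K]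
    (A : H →L[ℂ] H) (hA : A.IsPositive)
    (V : K →L[ℂ] H) (hV : adjoint V ∘L V = 1)
    (α : ℝ) (hα0 : 0 ≤ α) (hα1 : α ≤ 1) :
    (CFC.rpow (adjoint V ∘L A ∘L V) α - adjoint V ∘L CFC.rpow A α ∘L V).IsPositive := by
  have hA' : 0 ≤ A := (nonneg_iff_isPositive A).2 hA
  have hB : 0 ≤ adjoint V ∘L A ∘L V := (nonneg_iff_isPositive _).2 (hA.adjoint_conj V)
  rw [CFC.rpow_eq_pow, CFC.rpow_eq_pow]
  obtain rfl | hα0 := hα0.eq_or_lt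
  · rw [CFC.rpow_zero _ hA', CFC.rpow_zero _ hB, one_def (M₁ := H), id_comp, hV, sub_self]
    exact isPositive_zero
  obtain rfl | hα1 := hα1.eq_or_lt
  · rw [CFC.rpow_one _ hA', CFC.rpow_one _ hB, sub_self]
    exact isPositive_zero
  lift α to ℝ≥0 using hα0.le
  have hα : α ∈ Set.Ioo 0 1 := ⟨by exact_mod_cast hα0, by exact_mod_cast hα1⟩
  rw [← CFC.nnrpow_eq_rpow hα.1, ← CFC.nnrpow_eq_rpow hα.1]
  set p : H →L[ℂ] H := V ∘L adjoint V with hp_def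
  have hp : IsStarProjection p := by
    refine ⟨?_, ?_⟩
    · change p ∘L p = p
      rw [hp_def, comp_assoc, adjoint_comp_comp_of_isometry hV]
    · rw [isSelfAdjoint_iff', hp_def, adjoint_comp, adjoint_adjoint]
  have hpap : p * A * p = isometryConj V hV (adjoint V ∘L A ∘L V) := by
    simp only [isometryConj, hp_def, mul_def, comp_assoc]
    rfl
  have key := CFC.projection_conj_nnrpow_le hα hp hA'
  rw [hpap, ← CFC.map_nnrpow _ α hα.1 hB (hpap ▸ hp.isSelfAdjoint.conjugate_nonneg hA')] at key
  have hpos := (le_def _ _).1 key |>.adjoint_conj V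
  convert hpos using 1
  change _ = adjoint V ∘L (p ∘L (V ∘L _ ∘L adjoint V) ∘L p - p ∘L _ ∘L p) ∘L V
  simp only [hp_def, sub_comp, comp_sub, comp_assoc, adjoint_comp_comp_of_isometry hV, hV]
  rfl
end
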